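/- arXiv:1008.1931 — 3 statements merged into one kernel-verified Lean document; each statement's English description precedes it below -/
import Mathlib

section
/- Let p ∈ ℝ[x₁,…,xₙ] be a real zero polynomial of degree d. If p has a symmetric determinantal representation (of any size k), then p has a symmetric determinantal representation of size n·d. -/
open MvPolynomial Matrix

/-- The monic symmetric linear matrix polynomial `I + x₁M₁ + ⋯ + xₙMₙ`, with real
symmetric coefficient matrices. -/
noncomputable def pencilR {n k : ℕ} (M : Fin n → Matrix (Fin k) (Fin k) ℝ) :
    Matrix (Fin k) (Fin k) (MvPolynomial (Fin n) ℝ) :=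
  1 + ∑ i, (M i).map (fun c => MvPolynomial.C c * MvPolynomial.X i)

/-- `p` is a real zero polynomial. -/
def IsRZ {n : ℕ} (p : MvPolynomial (Fin n) ℝ) : Prop :=
  MvPolynomial.eval (0 : Fin n → ℝ) p = 1 ∧
  ∀ (a : Fin n → ℝ) (μ : ℂ),
    MvPolynomial.eval (fun i => μ * (a i : ℂ)) (MvPolynomial.map (algebraMap ℝ ℂ) p) = 0 →
    μ.im = 0

/-- `p` has a symmetric determinantal representation of size `k`. -/
def HasSymmRep {n : ℕ} (p : MvPolynomial (Fin n) ℝ) (k : ℕ) : Prop :=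
  ∃ M : Fin n → Matrix (Fin k) (Fin k) ℝ, (∀ i, (M i).IsSymm) ∧ p = (pencilR M).det

/-- The rank of a real symmetric matrix is the degree of `det (1 - X • A)`. -/
lemma Matrix.IsHermitian.rank_eq_natDegree_charpolyRev {k : ℕ} {A : Matrix (Fin k) (Fin k) ℝ}
    (hA : A.IsHermitian) : A.rank = A.charpolyRev.natDegree := by
  rw [← reverse_charpoly, Polynomial.reverse_natDegree, charpoly_natDegree_eq_dim,
    ← Polynomial.rootMultiplicity_eq_natTrailingDegree', ← Polynomial.count_roots,
    hA.roots_charpoly_eq_eigenvalues, hA.rank_eq_card_non_zero_eigs, Multiset.count_map,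
    Fintype.card_subtype_compl]
  simp [Fintype.card_subtype, Finset.card, eq_comm]

/-- Substituting `-X` for the `i`-th variable and `0` for the others in the determinant of a
pencil. -/
lemma aeval_det_pencilR_single {n k : ℕ} (M : Fin n → Matrix (Fin k) (Fin k) ℝ) (i : Fin n) :
    aeval (Pi.single i (-Polynomial.X) : Fin n → Polynomial ℝ) (pencilR M).det =
      (M i).charpolyRev := by
  rw [AlgHom.map_det, charpolyRev]
  congr 1
  ext1 a b
  simp only [pencilR, AlgHom.mapMatrix_apply, Matrix.map_apply, Matrix.add_apply,
    Matrix.sum_apply, map_add, map_sum, map_mul, aeval_X, aeval_C, Matrix.sub_apply,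
    Matrix.smul_apply, Pi.single_apply, Finset.sum_ite_eq', Finset.mem_univ, if_true,
    mul_ite, mul_zero, Matrix.one_apply]
  split_ifs <;> simp
  all_goals ring

lemma rank_le_totalDegree_det_pencilR {n k : ℕ} {M : Fin n → Matrix (Fin k) (Fin k) ℝ}
    (hM : ∀ i, (M i).IsSymm) (i : Fin n) : (M i).rank ≤ (pencilR M).det.totalDegree := by
  have hH : (M i).IsHermitian := by
    rw [IsHermitian, conjTranspose_eq_transpose_of_trivial]
    exact hM i
  rw [hH.rank_eq_natDegree_charpolyRev, ← aeval_det_pencilR_single M i]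
  refine (aeval_natDegree_le (n := 1) _ le_rfl _ fun j => ?_).trans_eq (mul_one _)
  rw [Pi.single_apply]
  split_ifs <;> simp

lemma Submodule.finrank_finsetSup_le {K V ι : Type*} [DivisionRing K] [AddCommGroup V]
    [Module K V] [FiniteDimensional K V] (s : Finset ι) (W : ι → Submodule K V) :
    Module.finrank K (s.sup W : Submodule K V) ≤ ∑ i ∈ s, Module.finrank K (W i) := by
  classical
  induction s using Finset.induction_on with
  | empty => simp
  | insert a s ha ih =>
    rw [Finset.sup_insert, Finset.sum_insert ha]
    exact (Submodule.finrank_add_le_finrank_add_finrank _ _).trans (by gcongr)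

/-- A subspace of dimension at most `m` is fixed pointwise by `B * Bᵀ` for some matrix `B` with
`m` columns. -/
lemma exists_mul_transpose_mulVec_eq {k m : ℕ} (V : Submodule ℝ (EuclideanSpace ℝ (Fin k)))
    (hV : Module.finrank ℝ V ≤ m) :
    ∃ B : Matrix (Fin k) (Fin m) ℝ, ∀ v ∈ V, (B * Bᵀ) *ᵥ v.ofLp = v.ofLp := by
  let b := stdOrthonormalBasis ℝ V
  refine ⟨Matrix.of fun a j => if h : j.1 < Module.finrank ℝ V then (b ⟨j, h⟩).1 a else 0,
    fun v hv => ?_⟩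
  obtain ⟨c, rfl⟩ := Nat.exists_eq_add_of_le hV
  have key := congrArg (fun w : V => (w : EuclideanSpace ℝ (Fin k))) (b.sum_repr' ⟨v, hv⟩)
  rw [← mulVec_mulVec]
  ext a
  have ha := congrArg (fun w : EuclideanSpace ℝ (Fin k) => w a) key
  simp only [Submodule.coe_sum, Submodule.coe_smul, WithLp.ofLp_sum, Finset.sum_apply,
    WithLp.ofLp_smul, Pi.smul_apply, smul_eq_mul, Submodule.coe_inner] at ha
  rw [← ha, mulVec, dotProduct, Fin.sum_univ_add]
  simp [mulVec, dotProduct, PiLp.inner_apply, mul_comm]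

lemma exists_mul_transpose_mul_eq {n k d : ℕ} (M : Fin n → Matrix (Fin k) (Fin k) ℝ)
    (hM : ∀ i, (M i).rank ≤ d) :
    ∃ B : Matrix (Fin k) (Fin (n * d)) ℝ, ∀ i, B * Bᵀ * M i = M i := by
  let W i := LinearMap.range (toEuclideanLin (M i))
  have hW i : Module.finrank ℝ (W i) ≤ d := by
    refine le_of_eq_of_le ?_ (hM i)
    exact (rank_eq_finrank_range_toLin (M i) (PiLp.basisFun 2 ℝ (Fin k))
      (PiLp.basisFun 2 ℝ (Fin k))).symm
  obtain ⟨B, hB⟩ := exists_mul_transpose_mulVec_eq (m := n * d) (Finset.univ.sup W) <|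
    (Submodule.finrank_finsetSup_le _ _).trans <|
      (Finset.sum_le_sum fun i _ => hW i).trans (by simp)
  refine ⟨B, fun i => Matrix.toLin'.injective (LinearMap.ext fun v => ?_)⟩
  have hv : toEuclideanLin (M i) (WithLp.toLp 2 v) ∈ Finset.univ.sup W :=
    Finset.le_sup (f := W) (Finset.mem_univ i) ⟨_, rfl⟩
  simpa [← mulVec_mulVec, Matrix.mul_assoc] using hB _ hv

lemma pencilR_eq {n k : ℕ} (M : Fin n → Matrix (Fin k) (Fin k) ℝ) :
    pencilR M = 1 + ∑ i, (X i : MvPolynomial (Fin n) ℝ) • (M i).map C := by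
  unfold pencilR
  congr! 2 with i
  ext1 a b
  simp [mul_comm]

lemma det_pencilR_eq_of_mul_transpose_mul_eq {n k m : ℕ} (M : Fin n → Matrix (Fin k) (Fin k) ℝ)
    (B : Matrix (Fin k) (Fin m) ℝ) (hB : ∀ i, B * Bᵀ * M i = M i) :
    (pencilR M).det = (pencilR fun i => Bᵀ * M i * B).det := by
  have h : ∑ i, (X i : MvPolynomial (Fin n) ℝ) • (M i).map (C (σ := Fin n)) =
      B.map (C (σ := Fin n)) * (Bᵀ.map (C (σ := Fin n)) *
        ∑ i, (X i : MvPolynomial (Fin n) ℝ) • (M i).map (C (σ := Fin n))) := by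
    simp only [Matrix.mul_sum, Matrix.mul_smul, ← Matrix.map_mul, ← Matrix.mul_assoc, hB]
  rw [pencilR_eq, pencilR_eq, h, det_one_add_mul_comm]
  simp only [Matrix.mul_sum, Matrix.sum_mul, Matrix.mul_smul, Matrix.smul_mul, Matrix.map_mul]

/-- If a real zero polynomial of degree `d` in `n` variables has a symmetric determinantal
representation of some size, then it has one of size `n·d`. -/
theorem symmRep_of_size_nd {n : ℕ} (p : MvPolynomial (Fin n) ℝ) (hrz : IsRZ p)
    (d : ℕ) (hd : p.totalDegree = d) (k : ℕ) (h : HasSymmRep p k) :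
    HasSymmRep p (n * d) := by
  obtain ⟨M, hM, rfl⟩ := h
  obtain ⟨B, hB⟩ := exists_mul_transpose_mul_eq M fun i =>
    (rank_le_totalDegree_det_pencilR hM i).trans_eq hd
  refine ⟨fun i => Bᵀ * M i * B, fun i => ?_, det_pencilR_eq_of_mul_transpose_mul_eq M B hB⟩
  simp only [IsSymm, transpose_mul, transpose_transpose, (hM i).eq, Matrix.mul_assoc]
end

section
/- Let ℳ = I + x₁M₁ + ⋯ + xₙMₙ be a monic hermitian linear matrix polynomial of size k whose spectrahedron S(ℳ) ⊆ ℝⁿ does not contain a full line. Let d be the total degree of p = det ℳ and assume n > binom(2d+1, 2) = d(2d+1). Then k ≥ n/(2d) + (d−1)/4 (inequality of real numbers). -/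
open MvPolynomial Matrix
open scoped ComplexOrder

/-- The monic hermitian linear matrix polynomial `I + x₁M₁ + ⋯ + xₙMₙ`. -/
noncomputable def pencil {n k : ℕ} (M : Fin n → Matrix (Fin k) (Fin k) ℂ) :
    Matrix (Fin k) (Fin k) (MvPolynomial (Fin n) ℂ) :=
  1 + ∑ i, (M i).map (fun c => MvPolynomial.C c * MvPolynomial.X i)

/-- The determinant of a linear pencil of size `k` has total degree at most `k`. -/
theorem totalDegree_det_pencil_le {n k : ℕ} (M : Fin n → Matrix (Fin k) (Fin k) ℂ) :
    (pencil M).det.totalDegree ≤ k := by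
  rw [det_apply]
  refine totalDegree_finsetSum_le fun σ _ => ?_
  refine (totalDegree_smul_le _ _).trans ((totalDegree_finsetProd _ _).trans ?_)
  refine (Finset.sum_le_card_nsmul _ _ 1 fun i _ => ?_).trans (by simp)
  rw [pencil, Matrix.add_apply, Matrix.sum_apply]
  refine (totalDegree_add _ _).trans (max_le ?_ ?_)
  · rw [Matrix.one_apply]; split_ifs <;> simp
  · refine totalDegree_finsetSum_le fun j _ => (totalDegree_mul _ _).trans ?_
    simp

/-- If no matrix `diagonal D + u • B` has larger rank than `diagonal D`, then `B` vanishes on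
the block of zero diagonal entries of `D`. -/
theorem corner_eq_zero {k : Type*} [Fintype k] [DecidableEq k] (D : k → ℂ) (B : Matrix k k ℂ)
    (h : ∀ u : ℝ, (diagonal D + (u : ℂ) • B).rank ≤ Fintype.card {i // D i ≠ 0})
    {i j : k} (hi : D i = 0) (hj : D j = 0) : B i j = 0 := by
  let S := {i // D i ≠ 0}
  let r (i : k) : S ⊕ Unit → k := Sum.elim Subtype.val fun _ => i
  let f (u : ℝ) : ℂ := (fromBlocks (diagonal (fun s : S => D s) +
    (u : ℂ) • B.submatrix Subtype.val Subtype.val) (of fun (s : S) (_ : Unit) => B s j)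
    (of fun (_ : Unit) (s : S) => (u : ℂ) * B i s) (of fun _ _ => B i j)).det
  have hf0 : ∀ u : ℝ, u ≠ 0 → f u = 0 := by
    intro u hu
    by_contra hne
    have key : (diagonal D + (u : ℂ) • B).submatrix (r i) (r j) =
      fromBlocks (diagonal (fun s : S => D s) +
        (u : ℂ) • B.submatrix Subtype.val Subtype.val) (of fun (s : S) (_ : Unit) => B s j)
        (of fun (_ : Unit) (s : S) => (u : ℂ) * B i s) (of fun _ _ => B i j) *
      fromBlocks 1 0 0 (diagonal fun _ : Unit => (u : ℂ)) := by
      rw [fromBlocks_multiply]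
      ext (a | a) (b | b)
      · simp [r, diagonal_apply, Subtype.coe_inj]
      · have : (a : k) ≠ j := fun e => a.2 (e ▸ hj)
        simp [r, this, mul_comm, mul_apply]
      · have : i ≠ (b : k) := fun e => b.2 (e ▸ hi)
        simp [r, this]
      · have : diagonal D i j = 0 := by rw [diagonal_apply]; split_ifs <;> simp [hi]
        simp [r, this, mul_comm, mul_apply]
    have hdet : ((diagonal D + (u : ℂ) • B).submatrix (r i) (r j)).det ≠ 0 := by
      rw [key, det_mul, det_fromBlocks_zero₂₁, det_one, one_mul]
      exact mul_ne_zero hne (by simpa using hu)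
    have h1 := rank_of_isUnit _ ((isUnit_iff_isUnit_det _).2 hdet.isUnit)
    have h2 := (rank_submatrix_le (diagonal D + (u : ℂ) • B) (r i) (r j)).trans (h u)
    rw [h1, Fintype.card_sum, Fintype.card_unit] at h2
    exact absurd h2 (by simp [S])
  have hcont : Continuous f := by
    refine Continuous.matrix_det (Continuous.matrix_fromBlocks ?_ ?_ ?_ ?_)
    · fun_prop
    · fun_prop
    · refine continuous_matrix fun a b => ?_
      simp only [of_apply]
      fun_prop
    · fun_prop
  have h0 : f 0 = 0 := by
    have := hcont.ext_on (dense_compl_singleton (0 : ℝ)) continuous_const (g := fun _ => (0 : ℂ))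
      (fun u hu => hf0 u hu)
    exact congrFun this 0
  have h1 : f 0 = (∏ s : S, D s) * B i j := by
    have : (of fun (_ : Unit) (s : S) => ((0 : ℝ) : ℂ) * B i s) = 0 := by ext; simp
    simp only [f, this, det_fromBlocks_zero₂₁]
    simp
  rw [h1, mul_eq_zero] at h0
  exact h0.resolve_left (Finset.prod_ne_zero_iff.2 fun s _ => s.2)

/-- A real space of hermitian matrices of size `k` that vanish on the block outside `S`
has dimension at most `k ^ 2 - (k - #S) ^ 2`. -/
theorem finrank_le_of_corner_eq_zero {V : Type*} [AddCommGroup V] [Module ℝ V]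
    {k : ℕ} (G : V →ₗ[ℝ] Matrix (Fin k) (Fin k) ℂ) (hG : Function.Injective G)
    (hH : ∀ v, (G v).IsHermitian) (S : Finset (Fin k))
    (h0 : ∀ v i j, i ∉ S → j ∉ S → G v i j = 0) :
    Module.finrank ℝ V + (k - S.card) ^ 2 ≤ k ^ 2 := by
  classical
  let T : Finset (Fin k × Fin k) := Sᶜ ×ˢ Sᶜ
  let L : V →ₗ[ℝ] ((Tᶜ : Finset (Fin k × Fin k)) → ℝ) := LinearMap.pi fun t =>
    (if t.1.1 ≤ t.1.2 then Complex.reLm else Complex.imLm) ∘ₗ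
      (Matrix.entryLinearMap ℝ ℂ t.1.1 t.1.2) ∘ₗ G
  have hL : Function.Injective L := by
    rw [← LinearMap.ker_eq_bot, LinearMap.ker_eq_bot']
    intro v hv
    have hre : ∀ i j, i ≤ j → (G v i j).re = 0 := by
      intro i j hij
      by_cases hT : (i, j) ∈ T
      · simp only [T, Finset.mem_product, Finset.mem_compl] at hT
        simp [h0 v i j hT.1 hT.2]
      · simpa [L, hij] using congrFun hv ⟨(i, j), Finset.mem_compl.2 hT⟩
    have him : ∀ i j, j < i → (G v i j).im = 0 := by
      intro i j hij
      by_cases hT : (i, j) ∈ T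
      · simp only [T, Finset.mem_product, Finset.mem_compl] at hT
        simp [h0 v i j hT.1 hT.2]
      · simpa [L, hij.not_ge] using congrFun hv ⟨(i, j), Finset.mem_compl.2 hT⟩
    refine hG ?_
    rw [map_zero]
    ext i j
    have hs := (hH v).apply i j
    rw [← hs]
    have hs' := Complex.ext_iff.1 hs
    simp only [Complex.star_def, Complex.conj_re, Complex.conj_im] at hs'
    rcases lt_trichotomy i j with h | h | h
    · apply Complex.ext
      · simp [hs'.1, hre i j h.le]
      · simp [him j i h]
    · subst h
      apply Complex.ext
      · simp [hre i i le_rfl]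
      · simp only [Complex.star_def, Complex.conj_im, Matrix.zero_apply, Complex.zero_im]
        linarith
    · apply Complex.ext
      · simp [hre j i h.le]
      · have := him i j h
        simp only [Complex.star_def, Complex.conj_im, Matrix.zero_apply, Complex.zero_im]
        linarith
  have h1 := LinearMap.finrank_le_finrank_of_injective hL
  have h2 := Finset.card_add_card_compl T
  simp only [Module.finrank_fintype_fun_eq_card, Fintype.card_coe] at h1
  have h3 : T.card = (k - S.card) ^ 2 := by
    simp [T, Finset.card_product, Finset.card_compl, sq]
  simp only [Fintype.card_prod, Fintype.card_fin] at h2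
  rw [← h3, sq]
  omega

/-- The rank of a hermitian real combination of the coefficients of a pencil is bounded by the
degree of its determinant. -/
theorem rank_le_totalDegree {n k : ℕ} (M : Fin n → Matrix (Fin k) (Fin k) ℂ)
    (v : Fin n → ℝ) (hA : (∑ i, (v i : ℂ) • M i).IsHermitian) :
    (∑ i, (v i : ℂ) • M i).rank ≤ (pencil M).det.totalDegree := by
  let φ : MvPolynomial (Fin n) ℂ →ₐ[ℂ] Polynomial ℂ :=
    aeval fun i => Polynomial.C (v i : ℂ) * Polynomial.X
  have hle : (φ (pencil M).det).natDegree ≤ (pencil M).det.totalDegree := by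
    simpa using aeval_natDegree_le _ le_rfl _ (n := 1) fun i =>
      Polynomial.natDegree_C_mul_le (v i : ℂ) Polynomial.X |>.trans Polynomial.natDegree_X_le
  set A := ∑ i, (v i : ℂ) • M i with hAdef
  have hφ : φ (pencil M).det = ∏ i, (1 + Polynomial.C (hA.eigenvalues i : ℂ) * Polynomial.X) := by
    refine Polynomial.funext fun t => ?_
    have h1 : Polynomial.eval t (φ (pencil M).det) = (1 + t • A).det := by
      rw [← Polynomial.coe_evalRingHom, ← RingHom.coe_coe φ, ← RingHom.comp_apply, RingHom.map_det]
      congr 1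
      ext i j
      simp only [pencil, RingHom.mapMatrix_apply, map_apply, Matrix.add_apply, Matrix.sum_apply,
        map_add, map_sum, map_mul, hAdef, Matrix.smul_apply, smul_eq_mul, Finset.mul_sum]
      congr 1
      · simp only [Matrix.one_apply]; split_ifs <;> simp
      · refine Finset.sum_congr rfl fun x _ => ?_
        simp [φ]
        ring
    have h2 : 1 + t • A = (hA.eigenvectorUnitary : Matrix (Fin k) (Fin k) ℂ) *
        diagonal (fun i => 1 + t * (hA.eigenvalues i : ℂ)) *
        star (hA.eigenvectorUnitary : Matrix (Fin k) (Fin k) ℂ) := by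
      have hd : diagonal (fun i => 1 + t * (hA.eigenvalues i : ℂ)) =
          1 + t • diagonal (RCLike.ofReal ∘ hA.eigenvalues) := by
        ext i j
        rw [← diagonal_one, ← diagonal_smul, diagonal_add]
        rfl
      conv_lhs => rw [hA.spectral_theorem, Unitary.conjStarAlgAut_apply]
      rw [hd, mul_add, add_mul, mul_one, Unitary.mul_star_self_of_mem hA.eigenvectorUnitary.2]
      simp
    rw [h1, h2, det_mul_right_comm, Unitary.mul_star_self_of_mem hA.eigenvectorUnitary.2, one_mul, det_diagonal,
      Polynomial.eval_prod]
    refine Finset.prod_congr rfl fun i _ => ?_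
    rw [Polynomial.eval_add, Polynomial.eval_one, Polynomial.eval_mul, Polynomial.eval_C,
      Polynomial.eval_X, mul_comm]
  refine le_trans ?_ hle
  rw [hφ, Polynomial.natDegree_prod, hA.rank_eq_card_non_zero_eigs, Fintype.card_subtype,
    Finset.card_filter]
  · refine Finset.sum_le_sum fun i _ => ?_
    split_ifs with h
    · rw [add_comm, ← Polynomial.C_1, Polynomial.natDegree_linear (by simpa using h)]
    · simp
  · intro i _ h
    simpa using congrArg (Polynomial.eval 0) h

/-- Lower bound on the size `k` of a hermitian linear matrix polynomial whose spectrahedron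
contains no full line, in terms of the number of variables `n` and the degree `d` of its
determinant `p`, provided `n > binom(2d+1, 2) = d(2d+1)`. -/
theorem size_lower_bound_herm {n k : ℕ} (M : Fin n → Matrix (Fin k) (Fin k) ℂ)
    (hM : ∀ i, (M i).IsHermitian)
    (hline : ¬ ∃ (a v : Fin n → ℝ), v ≠ 0 ∧ ∀ t : ℝ,
      (1 + ∑ i, ((a i + t * v i : ℝ) : ℂ) • M i).PosSemidef)
    (p : MvPolynomial (Fin n) ℝ)
    (hp : MvPolynomial.map (algebraMap ℝ ℂ) p = (pencil M).det)
    (d : ℕ) (hd : p.totalDegree = d)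
    (hn : Nat.choose (2 * d + 1) 2 < n) :
    (k : ℝ) ≥ (n : ℝ) / (2 * d) + ((d : ℝ) - 1) / 4 := by
  have hdeg : (pencil M).det.totalDegree = d := by
    rw [← hp, ← hd, totalDegree, totalDegree,
      support_map_of_injective _ (algebraMap ℝ ℂ).injective]
  have hdk : d ≤ k := hdeg ▸ totalDegree_det_pencil_le M
  let F : (Fin n → ℝ) →ₗ[ℝ] Matrix (Fin k) (Fin k) ℂ := Fintype.linearCombination ℝ M
  have hF : ∀ v, F v = ∑ i, (v i : ℂ) • M i := fun v => by
    simp [F, Fintype.linearCombination_apply]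
  have hFH : ∀ v, (F v).IsHermitian := fun v => by
    rw [hF, IsHermitian, conjTranspose_sum]
    simp [conjTranspose_smul, (hM _).eq]
  have hFinj : Function.Injective F := by
    rw [← LinearMap.ker_eq_bot, LinearMap.ker_eq_bot']
    intro v hv
    by_contra hne
    refine hline ⟨0, v, hne, fun t => ?_⟩
    have : ∑ i, (((0 : Fin n → ℝ) i + t * v i : ℝ) : ℂ) • M i = F (t • v) := by simp [hF]
    rw [this, map_smul, hv, smul_zero, add_zero]
    exact PosSemidef.one
  have hrank : ∀ v, (F v).rank ≤ d := fun v => by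
    have := rank_le_totalDegree M v (hF v ▸ hFH v)
    rwa [← hF, hdeg] at this
  obtain ⟨v₀, hv₀⟩ : ∃ v₀, ∀ v, (F v).rank ≤ (F v₀).rank := by
    have hbdd : BddAbove (Set.range fun v => (F v).rank) :=
      ⟨d, by rintro _ ⟨v, rfl⟩; exact hrank v⟩
    obtain ⟨v₀, h⟩ := Nat.sSup_mem (Set.range_nonempty _) hbdd
    exact ⟨v₀, fun v => (le_csSup hbdd ⟨v, rfl⟩).trans h.ge⟩
  have hA := hFH v₀
  let U : Matrix (Fin k) (Fin k) ℂ := hA.eigenvectorUnitary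
  have hUU : U * star U = 1 := Unitary.mul_star_self_of_mem hA.eigenvectorUnitary.2
  have hU : IsUnit U.det := (isUnit_iff_isUnit_det _).1 (IsUnit.of_mul_eq_one _ hUU)
  have hU' : IsUnit (star U).det := (isUnit_iff_isUnit_det _).1
    (IsUnit.of_mul_eq_one _ (mul_eq_one_comm.1 hUU))
  let G : (Fin n → ℝ) →ₗ[ℝ] Matrix (Fin k) (Fin k) ℂ :=
    LinearMap.mulRight ℝ U ∘ₗ LinearMap.mulLeft ℝ (star U) ∘ₗ F
  have hG : ∀ v, G v = star U * F v * U := fun v => rfl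
  have hGrank : ∀ v, (G v).rank = (F v).rank := fun v => by
    rw [hG, rank_mul_eq_left_of_isUnit_det _ _ hU, rank_mul_eq_right_of_isUnit_det _ _ hU']
  have hGinj : Function.Injective G := by
    intro v w h
    refine hFinj ?_
    have h2 : ∀ x, U * G x * star U = F x := fun x => by
      calc U * G x * star U = (U * star U) * F x * (U * star U) := by rw [hG]; noncomm_ring
        _ = F x := by simp [hUU]
    rw [← h2 v, h, h2]
  have hG₀ : G v₀ = diagonal (RCLike.ofReal ∘ hA.eigenvalues) := by
    rw [← hA.conjStarAlgAut_star_eigenvectorUnitary, Unitary.conjStarAlgAut_star_apply]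
    rfl
  let S : Finset (Fin k) := {i | hA.eigenvalues i ≠ 0}
  have hS : S.card = (F v₀).rank := by
    rw [hA.rank_eq_card_non_zero_eigs, Fintype.card_subtype]
  have hmain := finrank_le_of_corner_eq_zero G hGinj
    (fun v => by rw [hG]; exact isHermitian_conjTranspose_mul_mul U (hFH v)) S
    (fun v i j hi hj => by
      refine corner_eq_zero (RCLike.ofReal ∘ hA.eigenvalues) (G v) (fun u => ?_)
        (by simpa [S] using hi) (by simpa [S] using hj)
      have h1 : diagonal (RCLike.ofReal ∘ hA.eigenvalues) + (u : ℂ) • G v = G (v₀ + u • v) := by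
        rw [map_add, map_smul, hG₀, Complex.coe_smul]
      rw [h1, hGrank]
      refine (hv₀ _).trans ?_
      rw [← hS, Fintype.card_subtype]
      simp [S])
  have hSd : S.card ≤ d := hS ▸ hrank v₀
  have hfin : (n : ℝ) + (k - d) ^ 2 ≤ (k : ℝ) ^ 2 := by
    have : n + (k - d) ^ 2 ≤ k ^ 2 := by
      rw [Module.finrank_fintype_fun_eq_card, Fintype.card_fin] at hmain
      exact (Nat.add_le_add_left (Nat.pow_le_pow_left (Nat.sub_le_sub_left hSd k) 2) n).trans hmain
    rw [← Nat.cast_sub hdk]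
    exact_mod_cast this
  rcases Nat.eq_zero_or_pos d with rfl | hpos
  · have : (0 : ℝ) ≤ k := k.cast_nonneg
    norm_num
    linarith
  · have hd1 : (1 : ℝ) ≤ d := by exact_mod_cast hpos
    have hle : (n : ℝ) / (2 * d) ≤ k - (d - 1) / 4 := by
      rw [div_le_iff₀ (by linarith)]
      nlinarith
    linarith
end

section
/- Let n ≥ 2 and let p ∈ ℝ[x₁,…,xₙ] be a quadratic real zero polynomial (degree 2). Set r = 2^(⌊n/2⌋ − 1) and k = 2^⌊n/2⌋. Then p^r has a hermitian determinantal representation of size k: there exist complex hermitian k×k matrices M₁,…,Mₙ with p^r = det(I + x₁M₁ + ⋯ + xₙMₙ). -/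
open MvPolynomial Matrix

/-- `p` has a hermitian determinantal representation of size `k`. -/
def HasHermRep {n : ℕ} (p : MvPolynomial (Fin n) ℝ) (k : ℕ) : Prop :=
  ∃ M : Fin n → Matrix (Fin k) (Fin k) ℂ, (∀ i, (M i).IsHermitian) ∧
    MvPolynomial.map (algebraMap ℝ ℂ) p = (pencil M).det

/-- The determinant of a block matrix with scalar diagonal blocks and off-diagonal blocks whose
product is scalar. -/
theorem det_fromBlocks_smul_one {R κ : Type*} [CommRing R] [IsDomain R] [Fintype κ]
    [DecidableEq κ] (a d q : R) (ha : a ≠ 0) (B C : Matrix κ κ R) (h : C * B = q • 1) :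
    (fromBlocks (a • 1) B C (d • 1)).det = (a * d - q) ^ Fintype.card κ := by
  have key : fromBlocks (a • 1) B C (d • 1) * fromBlocks 1 (-B) 0 (a • 1) =
      fromBlocks (a • 1) 0 C ((a * d - q) • 1) := by
    rw [fromBlocks_multiply]
    congr 1
    · simp
    · simp
    · simp
    · rw [Matrix.mul_neg, h, smul_one_mul, smul_smul, sub_smul, mul_comm]
      abel
  have hdet := congrArg det key
  rw [det_mul, det_fromBlocks_zero₂₁, det_fromBlocks_zero₁₂] at hdet
  simp only [det_smul, det_one, mul_one, one_mul] at hdet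
  rw [mul_comm] at hdet
  exact mul_left_cancel₀ (pow_ne_zero _ ha) hdet

/-- The linear form with coefficient vector `c`. -/
noncomputable def linForm {R : Type*} [CommSemiring R] {n : ℕ} (c : Fin n → R) :
    MvPolynomial (Fin n) R :=
  ∑ i, C (c i) * X i

/-- The homogeneous linear matrix polynomial `x₁M₁ + ⋯ + xₙMₙ`. -/
noncomputable def linPencil {n : ℕ} {κ : Type*} (M : Fin n → Matrix κ κ ℂ) :
    Matrix κ κ (MvPolynomial (Fin n) ℂ) :=
  of fun a b => linForm fun i => M i a b

theorem map_linForm {R S : Type*} [CommSemiring R] [CommSemiring S] (f : R →+* S) {n : ℕ}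
    (c : Fin n → R) : map f (linForm c) = linForm fun i => f (c i) := by
  simp [linForm]

theorem eval_linForm {R : Type*} [CommSemiring R] {n : ℕ} (c x : Fin n → R) :
    eval x (linForm c) = ∑ i, c i * x i := by
  simp [linForm]

theorem linForm_add {R : Type*} [CommSemiring R] {n : ℕ} (c d : Fin n → R) :
    (linForm fun i => c i + d i) = linForm c + linForm d := by
  simp [linForm, add_mul, Finset.sum_add_distrib]

theorem linForm_mul_left {R : Type*} [CommSemiring R] {n : ℕ} (a : R) (c : Fin n → R) :
    (linForm fun i => a * c i) = C a * linForm c := by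
  simp [linForm, Finset.mul_sum, mul_assoc]

theorem linForm_neg {R : Type*} [CommRing R] {n : ℕ} (c : Fin n → R) :
    (linForm fun i => -c i) = -linForm c := by
  simp [linForm]

/-- The coefficients of the block matrix polynomial with diagonal `u`, `v` and off-diagonal
blocks `T ∓ √-1 y`. -/
noncomputable def blockCoeff {n : ℕ} {κ : Type*} [DecidableEq κ] (u v y : Fin n → ℝ)
    (T : Fin n → Matrix κ κ ℂ) (i : Fin n) : Matrix (κ ⊕ κ) (κ ⊕ κ) ℂ :=
  fromBlocks ((u i : ℂ) • 1) (T i + (-Complex.I * y i) • 1) (T i + (Complex.I * y i) • 1)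
    ((v i : ℂ) • 1)

theorem isHermitian_blockCoeff {n : ℕ} {κ : Type*} [DecidableEq κ] (u v y : Fin n → ℝ)
    (T : Fin n → Matrix κ κ ℂ) (hT : ∀ i, (T i).IsHermitian) (i : Fin n) :
    (blockCoeff u v y T i).IsHermitian := by
  refine IsHermitian.fromBlocks ?_ ?_ ?_
  · simp [IsHermitian]
  · simp [(hT i).eq]
  · simp [IsHermitian]

theorem linPencil_add {n : ℕ} {κ : Type*} (S T : Fin n → Matrix κ κ ℂ) :
    (linPencil fun i => S i + T i) = linPencil S + linPencil T := by
  ext1 a b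
  exact linForm_add _ _

theorem linPencil_smul_one {n : ℕ} {κ : Type*} [DecidableEq κ] (c : Fin n → ℂ) :
    (linPencil fun i => c i • (1 : Matrix κ κ ℂ)) = linForm c • 1 := by
  ext1 a b
  by_cases h : a = b <;> simp [linPencil, linForm, h, one_apply]

theorem linPencil_blockCoeff {n : ℕ} {κ : Type*} [DecidableEq κ] (u v y : Fin n → ℝ)
    (T : Fin n → Matrix κ κ ℂ) :
    linPencil (blockCoeff u v y T) =
      fromBlocks (map (algebraMap ℝ ℂ) (linForm u) • 1)
        (linPencil T + (C (-Complex.I) * MvPolynomial.map (algebraMap ℝ ℂ) (linForm y)) • 1)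
        (linPencil T + (C Complex.I * MvPolynomial.map (algebraMap ℝ ℂ) (linForm y)) • 1)
        (map (algebraMap ℝ ℂ) (linForm v) • 1) := by
  simp only [map_linForm, ← linForm_mul_left, ← linPencil_smul_one, ← linPencil_add]
  ext1 a b
  rcases a with a | a <;> rcases b with b | b <;> rfl

theorem C_I_mul_self {n : ℕ} :
    (C Complex.I * C Complex.I : MvPolynomial (Fin n) ℂ) = -1 := by
  rw [← C_mul, Complex.I_mul_I, C_neg, C_1]

theorem add_smul_one_mul_sub_smul_one {R κ : Type*} [CommRing R] [Fintype κ] [DecidableEq κ]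
    {N : Matrix κ κ R} {q : R} (h : N * N = q • 1) (a : R) :
    (N + a • 1) * (N + (-a) • 1) = (q - a * a) • 1 := by
  simp only [add_mul, mul_add, h, Algebra.smul_mul_assoc, Algebra.mul_smul_comm, one_mul, mul_one]
  module

theorem offDiag_mul {n : ℕ} {κ : Type*} [Fintype κ] [DecidableEq κ]
    (N : Matrix κ κ (MvPolynomial (Fin n) ℂ)) (q y : MvPolynomial (Fin n) ℂ)
    (h : N * N = q • 1) :
    (N + (C Complex.I * y) • 1) * (N + (C (-Complex.I) * y) • 1) = (q + y ^ 2) • 1 ∧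
    (N + (C (-Complex.I) * y) • 1) * (N + (C Complex.I * y) • 1) = (q + y ^ 2) • 1 := by
  have h₁ := add_smul_one_mul_sub_smul_one h (C Complex.I * y)
  have h₂ := add_smul_one_mul_sub_smul_one h (-(C Complex.I * y))
  have e : q - C Complex.I * y * (C Complex.I * y) = q + y ^ 2 := by
    linear_combination -y ^ 2 * C_I_mul_self (n := n)
  rw [neg_mul_neg, neg_neg] at h₂
  rw [e] at h₁ h₂
  rw [C_neg, neg_mul]
  exact ⟨h₁, h₂⟩

theorem fromBlocks_smul_one_mul_self {R κ : Type*} [CommRing R] [Fintype κ] [DecidableEq κ]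
    (z q : R) {B C : Matrix κ κ R} (hBC : B * C = q • 1) (hCB : C * B = q • 1) :
    fromBlocks (z • 1) B C ((-z) • 1) * fromBlocks (z • 1) B C ((-z) • 1) =
      (q + z ^ 2) • 1 := by
  rw [fromBlocks_multiply, hBC, hCB, ← fromBlocks_one, fromBlocks_smul]
  simp only [Algebra.smul_mul_assoc, Algebra.mul_smul_comm, one_mul, mul_one]
  congr 1 <;> module

/-- A sum of `2m + 1` squares of real linear forms is the square of a hermitian linear matrix
polynomial of size `2^m`. -/
theorem exists_linPencil_sq {n : ℕ} (l : ℕ → Fin n → ℝ) (m : ℕ) :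
    ∃ (κ : Type) (_ : Fintype κ) (_ : DecidableEq κ) (T : Fin n → Matrix κ κ ℂ),
      Fintype.card κ = 2 ^ m ∧ (∀ i, (T i).IsHermitian) ∧
      linPencil T * linPencil T =
        map (algebraMap ℝ ℂ) (∑ k ∈ Finset.range (2 * m + 1), linForm (l k) ^ 2) • 1 := by
  induction m with
  | zero =>
    refine ⟨Unit, inferInstance, inferInstance, fun i => (l 0 i : ℂ) • 1, by simp, ?_, ?_⟩
    · intro i
      simp [IsHermitian]
    · rw [linPencil_smul_one]
      simp [map_linForm, smul_smul, sq]
  | succ m ih =>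
    obtain ⟨κ, _, _, T, hcard, hT, hsq⟩ := ih
    refine ⟨κ ⊕ κ, inferInstance, inferInstance,
      blockCoeff (l (2 * m + 1)) (-l (2 * m + 1)) (l (2 * m + 2)) T, ?_,
      isHermitian_blockCoeff _ _ _ _ hT, ?_⟩
    · rw [Fintype.card_sum, hcard, pow_succ]
      ring
    · have hneg : linForm (-l (2 * m + 1)) = -linForm (l (2 * m + 1)) := linForm_neg _
      obtain ⟨h₁, h₂⟩ := offDiag_mul (linPencil T) _
        (map (algebraMap ℝ ℂ) (linForm (l (2 * m + 2)))) hsq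
      rw [linPencil_blockCoeff, hneg, map_neg (MvPolynomial.map _), fromBlocks_smul_one_mul_self _ _ h₂ h₁,
        show 2 * (m + 1) + 1 = 2 * m + 1 + 1 + 1 by ring,
        Finset.sum_range_succ _ (2 * m + 1 + 1), Finset.sum_range_succ _ (2 * m + 1)]
      simp only [map_add, map_pow]
      rw [add_right_comm]

theorem pencil_eq_reindex {n k : ℕ} {κ : Type*} [DecidableEq κ] (e : κ ≃ Fin k)
    (M : Fin n → Matrix κ κ ℂ) :
    pencil (fun i => reindex e e (M i)) = reindex e e (1 + linPencil M) := by
  ext1 a b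
  simp [pencil, linPencil, linForm, Matrix.sum_apply, one_apply]

/-- Powers of a polynomial `(1 + b)² - (l₀² + ⋯ + l_{2m+2}²)` with real linear forms `b`, `lₖ` have
hermitian determinantal representations. -/
theorem hasHermRep_pow_of_sq_sub_sum_sq {n : ℕ} (b : Fin n → ℝ) (l : ℕ → Fin n → ℝ) (m : ℕ) :
    HasHermRep (((1 + linForm b) ^ 2 -
      ∑ k ∈ Finset.range (2 * m + 3), linForm (l k) ^ 2) ^ 2 ^ m) (2 ^ (m + 1)) := by
  obtain ⟨κ, _, _, T, hcard, hT, hsq⟩ := exists_linPencil_sq l m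
  have hk : Fintype.card (κ ⊕ κ) = 2 ^ (m + 1) := by
    rw [Fintype.card_sum, hcard, pow_succ]
    ring
  let e := Fintype.equivFinOfCardEq hk
  let M := blockCoeff (b + l (2 * m + 1)) (b - l (2 * m + 1)) (l (2 * m + 2)) T
  refine ⟨fun i => reindex e e (M i), fun i => ?_, ?_⟩
  · exact (isHermitian_blockCoeff _ _ _ _ hT i).submatrix _
  · have hadd : linForm (b + l (2 * m + 1)) = linForm b + linForm (l (2 * m + 1)) :=
      linForm_add _ _
    have hsub : linForm (b - l (2 * m + 1)) = linForm b - linForm (l (2 * m + 1)) := by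
      rw [sub_eq_add_neg, sub_eq_add_neg, ← linForm_neg]
      exact linForm_add _ _
    have hne : (1 + map (algebraMap ℝ ℂ) (linForm (b + l (2 * m + 1)))) ≠ 0 := by
      intro h
      have := congrArg (eval 0) h
      rw [map_add, map_linForm, eval_linForm] at this
      simp at this
    rw [pencil_eq_reindex, det_reindex_self, linPencil_blockCoeff, ← fromBlocks_one,
      fromBlocks_add, zero_add, zero_add]
    have hone : ∀ q : MvPolynomial (Fin n) ℂ,
        (1 : Matrix κ κ (MvPolynomial (Fin n) ℂ)) + q • 1 = (1 + q) • 1 := fun q => by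
      rw [add_smul, one_smul]
    rw [hone, hone, det_fromBlocks_smul_one _ _ _ hne _ _ (offDiag_mul _ _ _ hsq).1, hcard,
      map_pow, hadd, hsub, Finset.sum_range_succ, Finset.sum_range_succ _ (2 * m + 1)]
    simp only [map_add, map_sub, map_pow, map_one]
    congr 1
    ring

theorem MvPolynomial.IsHomogeneous.exists_eq_linForm {n : ℕ} {p : MvPolynomial (Fin n) ℝ}
    (hp : p.IsHomogeneous 1) : ∃ b : Fin n → ℝ, p = linForm b := by
  refine ⟨fun i => coeff 0 (pderiv i p), ?_⟩
  have h := hp.sum_X_mul_pderiv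
  rw [one_smul] at h
  conv_lhs => rw [← h]
  refine Finset.sum_congr rfl fun i _ => ?_
  have hi : (pderiv i p).IsHomogeneous 0 := hp.pderiv
  rw [mul_comm, ← totalDegree_eq_zero_iff_eq_C.1 ((totalDegree_zero_iff_isHomogeneous _).2 hi)]

theorem MvPolynomial.IsHomogeneous.exists_eq_sum_X_mul_linForm {n : ℕ}
    {p : MvPolynomial (Fin n) ℝ} (hp : p.IsHomogeneous 2) :
    ∃ c : Matrix (Fin n) (Fin n) ℝ, c.IsHermitian ∧ p = ∑ i, X i * linForm (c i) := by
  have h₁ : ∀ i, ∃ b : Fin n → ℝ, pderiv i p = linForm b := fun i =>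
    IsHomogeneous.exists_eq_linForm (show (pderiv i p).IsHomogeneous (2 - 1) from hp.pderiv)
  choose b hb using h₁
  have h₂ : ∑ i, X i * linForm (b i) = 2 • p := by
    simpa only [hb] using hp.sum_X_mul_pderiv
  have h₃ : ∑ i, X i * linForm (fun j => b j i) = 2 • p := by
    rw [← h₂]
    simp only [linForm, Finset.mul_sum]
    rw [Finset.sum_comm]
    refine Finset.sum_congr rfl fun i _ => Finset.sum_congr rfl fun j _ => ?_
    ring
  refine ⟨of fun i j => (1 / 4 : ℝ) * (b i j + b j i), ?_, ?_⟩
  · ext i j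
    simp [add_comm]
  · have h₄ : (C (1 / 4) : MvPolynomial (Fin n) ℝ) * 4 = 1 := by
      rw [show (4 : MvPolynomial (Fin n) ℝ) = C 4 from (map_ofNat C 4).symm,
        ← MvPolynomial.C_mul]
      norm_num
    calc p = C (1 / 4) * (2 • p + 2 • p) := by
          rw [nsmul_eq_mul]
          push_cast
          linear_combination -p * h₄
      _ = ∑ i, X i * (C (1 / 4) * (linForm (b i) + linForm (fun j => b j i))) := by
          nth_rewrite 1 [← h₂]
          rw [← h₃, ← Finset.sum_add_distrib, Finset.mul_sum]
          refine Finset.sum_congr rfl fun i _ => ?_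
          ring
      _ = _ := by
          simp only [← linForm_add, ← linForm_mul_left]
          rfl

/-- A polynomial of degree at most two is the sum of a constant, a linear and a quadratic form. -/
theorem exists_eq_of_totalDegree_le_two {n : ℕ} {p : MvPolynomial (Fin n) ℝ}
    (hp : p.totalDegree ≤ 2) :
    ∃ (b : Fin n → ℝ) (c : Matrix (Fin n) (Fin n) ℝ), c.IsHermitian ∧
      p = C (eval 0 p) + linForm b + ∑ i, X i * linForm (c i) := by
  obtain ⟨b, hb⟩ := (homogeneousComponent_isHomogeneous 1 p).exists_eq_linForm
  obtain ⟨c, hc, hc'⟩ := (homogeneousComponent_isHomogeneous 2 p).exists_eq_sum_X_mul_linForm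
  refine ⟨b, c, hc, ?_⟩
  have h := sum_homogeneousComponent p
  have h' : ∑ i ∈ Finset.range 3, homogeneousComponent i p = p := by
    conv_rhs => rw [← h]
    symm
    refine Finset.sum_subset (Finset.range_mono (by lia)) fun i _ hi => ?_
    exact homogeneousComponent_eq_zero i p (by simpa using hi)
  rw [← hb, ← hc']
  conv_lhs => rw [← h']
  simp [Finset.sum_range_succ, constantCoeff_eq, eval_zero]

/-- A real quadratic polynomial `1 + 2βμ + γμ²` all of whose zeros are real has nonnegative
discriminant. -/
theorem le_sq_of_forall_im_eq_zero {β γ : ℝ}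
    (h : ∀ μ : ℂ, 1 + 2 * β * μ + γ * μ ^ 2 = 0 → μ.im = 0) : γ ≤ β ^ 2 := by
  by_contra! hlt
  have hγ : 0 < γ := (sq_nonneg β).trans_lt hlt
  have hs : 0 < √(γ - β ^ 2) := Real.sqrt_pos.2 (by linarith)
  have hs2 : ((√(γ - β ^ 2) : ℝ) : ℂ) ^ 2 = γ - β ^ 2 := by
    rw [← Complex.ofReal_pow, Real.sq_sqrt (by linarith)]
    push_cast
    ring
  have hγ' : (γ : ℂ) ≠ 0 := by exact_mod_cast hγ.ne'
  have him := h (((-β / γ : ℝ) : ℂ) + (√(γ - β ^ 2) / γ : ℝ) * Complex.I) (by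
    push_cast
    field_simp
    linear_combination Complex.I ^ 2 * hs2 + (γ - β ^ 2 : ℂ) * Complex.I_sq)
  rw [Complex.add_im, Complex.ofReal_im, Complex.im_ofReal_mul, Complex.I_im] at him
  have := div_pos hs hγ
  linarith

open scoped MatrixOrder in
/-- A positive semidefinite quadratic form is a sum of squares of linear forms. -/
theorem Matrix.PosSemidef.exists_sum_sq {n : ℕ} {S : Matrix (Fin n) (Fin n) ℝ}
    (hS : S.PosSemidef) :
    ∃ l : Fin n → Fin n → ℝ, ∑ i, X i * linForm (S i) = ∑ k, linForm (l k) ^ 2 := by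
  obtain ⟨B, rfl⟩ := CStarAlgebra.nonneg_iff_eq_star_mul_self.1 hS.nonneg
  refine ⟨B, ?_⟩
  simp only [linForm, mul_apply, sq, Finset.mul_sum, Finset.sum_mul, map_sum]
  rw [Finset.sum_comm_cycle]
  refine Finset.sum_congr rfl fun k _ => Finset.sum_congr rfl fun i _ =>
    Finset.sum_congr rfl fun j _ => ?_
  simp
  ring

/-- A real zero polynomial of degree at most two is the square of an affine form minus a sum of
squares of linear forms. -/
theorem IsRZ.exists_eq_sq_sub_sum_sq {n : ℕ} {p : MvPolynomial (Fin n) ℝ} (hrz : IsRZ p)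
    (hdeg : p.totalDegree ≤ 2) :
    ∃ (b : Fin n → ℝ) (l : Fin n → Fin n → ℝ),
      p = (1 + linForm b) ^ 2 - ∑ k, linForm (l k) ^ 2 := by
  obtain ⟨b, c, hc, hp⟩ := exists_eq_of_totalDegree_le_two hdeg
  rw [hrz.1, C_1] at hp
  let S : Matrix (Fin n) (Fin n) ℝ := of fun i j => (b i / 2) * (b j / 2) + -c i j
  have hpoly : ∑ i, X i * linForm (S i) =
      linForm (fun i => b i / 2) ^ 2 - ∑ i, X i * linForm (c i) := by
    have hi : ∀ i, linForm (S i) =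
        C (b i / 2) * linForm (fun i => b i / 2) + -linForm (c i) := fun i => by
      rw [← linForm_mul_left, ← linForm_neg, ← linForm_add]
      rfl
    simp only [hi, mul_add, Finset.sum_add_distrib, sq, mul_neg, Finset.sum_neg_distrib]
    rw [← sub_eq_add_neg]
    congr 1
    nth_rewrite 2 [linForm]
    rw [Finset.sum_mul]
    refine Finset.sum_congr rfl fun i _ => ?_
    ring
  have hS : S.PosSemidef := by
    refine .of_dotProduct_mulVec_nonneg ?_ fun a => ?_
    · ext i j
      have := hc.apply i j
      simp only [star_trivial] at this
      simp [S, this, mul_comm]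
    · have hquad : star a ⬝ᵥ (S *ᵥ a) = eval a (∑ i, X i * linForm (S i)) := by
        simp [dotProduct, mulVec, eval_linForm]
      rw [hquad, hpoly, map_sub, map_pow, sub_nonneg]
      refine le_sq_of_forall_im_eq_zero fun μ hμ => hrz.2 a μ ?_
      rw [← hμ, hp]
      simp only [map_linForm, eval_linForm, Finset.mul_sum, Finset.sum_mul, map_add, map_one,
        map_sum, map_mul, map_X, eval_X, Complex.coe_algebraMap, Complex.ofReal_sum,
        Complex.ofReal_mul, Complex.ofReal_div, Complex.ofReal_ofNat]
      congr 1
      · congr 1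
        exact Finset.sum_congr rfl fun i _ => by ring
      · exact Finset.sum_congr rfl fun i _ => Finset.sum_congr rfl fun j _ => by ring
  obtain ⟨l, hl⟩ := hS.exists_sum_sq
  refine ⟨fun i => b i / 2, l, ?_⟩
  have hb : linForm b = 2 * linForm (fun i => b i / 2) := by
    rw [show (2 : MvPolynomial (Fin n) ℝ) = C 2 from (map_ofNat C 2).symm, ← linForm_mul_left]
    congr 1
    ext i
    ring
  rw [← hl, hpoly, hp, hb]
  ring

/-- For a quadratic real zero polynomial `p` in `n ≥ 2` variables, the power `p^r` with
`r = 2^(⌊n/2⌋−1)` has a hermitian determinantal representation of size `2^⌊n/2⌋`. -/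
theorem quadratic_power_has_rep {n : ℕ} (hn : 2 ≤ n)
    (p : MvPolynomial (Fin n) ℝ) (hrz : IsRZ p) (hdeg : p.totalDegree = 2) :
    HasHermRep (p ^ (2 ^ (n / 2 - 1))) (2 ^ (n / 2)) := by
  obtain ⟨b, l, hp⟩ := hrz.exists_eq_sq_sub_sum_sq hdeg.le
  obtain ⟨m, hm⟩ : ∃ m, n / 2 = m + 1 := ⟨n / 2 - 1, by lia⟩
  let l' : ℕ → Fin n → ℝ := fun k => if h : k < n then l ⟨k, h⟩ else 0
  have hsum : ∑ k, linForm (l k) ^ 2 = ∑ k ∈ Finset.range (2 * m + 3), linForm (l' k) ^ 2 := by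
    rw [← Finset.sum_subset (Finset.range_mono (show n ≤ 2 * m + 3 by lia)), Finset.sum_range]
    · simp [l']
    · intro k _ hk
      have hk' : ¬ k < n := by simpa using hk
      simp [l', hk', linForm]
  rw [hm, Nat.add_sub_cancel, hp, hsum]
  exact hasHermRep_pow_of_sq_sub_sum_sq b l' m
end
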